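/- arXiv:1105.3441 — 2 statements merged into one kernel-verified Lean document; each statement's English description precedes it below -/
import Mathlib

section
/- Let μ be a Borel probability measure on the golden mean shift Σ_G, and define s(μ) = Σ_{k≥1} H^μ(α_k)/2^{k+1}, where α_k is the partition of Σ_G into cylinders of length k and H^μ denotes base-2 entropy of a partition. Then the Hausdorff dimension of X_G (with respect to the metric ρ on Σ₂) is at least s(μ). -/
open scoped ENNReal
open Filter MeasureTheory

/-- The space `Σ₂ = {0,1}^ℕ` of binary sequences indexed by the positive integers:
a point `x : SigmaTwo` represents the sequence `(x_k)_{k ≥ 1}` with `x_k = x (k - 1)`. -/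
def SigmaTwo : Type := ℕ → Fin 2

namespace SigmaTwo

/-- Reinterpret a point of `Σ₂` as a bare sequence. -/
def toSeq (x : SigmaTwo) : ℕ → Fin 2 := x

attribute [local instance] PiNat.dist

open Classical in
/-- The metric `ρ(x,y) = 2^{-min{n ≥ 1 : x_n ≠ y_n}}`: in the 0-indexed representation the
least positive-integer index (`≥ 1`) where `x` and `y` differ is `PiNat.firstDiff x y + 1`. -/
noncomputable def rho (x y : SigmaTwo) : ℝ :=
  if x = y then 0 else (2 : ℝ) ^ (-((PiNat.firstDiff (toSeq x) (toSeq y) : ℤ) + 1))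

theorem rho_eq_dist_div_two (x y : SigmaTwo) : rho x y = dist (toSeq x) (toSeq y) / 2 := by
  rcases eq_or_ne x y with rfl | h
  · have : dist (toSeq x) (toSeq x) = 0 := PiNat.dist_self _
    rw [rho, if_pos rfl, this]; norm_num
  · have h' : toSeq x ≠ toSeq y := h
    rw [rho, if_neg h, PiNat.dist_eq_of_ne h']
    rw [zpow_neg, zpow_add₀ (by norm_num : (2:ℝ) ≠ 0), zpow_natCast, zpow_one, mul_inv,
      one_div, inv_pow]
    ring

theorem rho_self (x : SigmaTwo) : rho x x = 0 := by
  rw [rho_eq_dist_div_two, PiNat.dist_self]; norm_num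

theorem rho_comm (x y : SigmaTwo) : rho x y = rho y x := by
  rw [rho_eq_dist_div_two, rho_eq_dist_div_two, PiNat.dist_comm]

theorem rho_triangle (x y z : SigmaTwo) : rho x z ≤ rho x y + rho y z := by
  rw [rho_eq_dist_div_two, rho_eq_dist_div_two, rho_eq_dist_div_two]
  have := PiNat.dist_triangle (toSeq x) (toSeq y) (toSeq z)
  linarith

theorem rho_eq_zero {x y : SigmaTwo} (h : rho x y = 0) : x = y := by
  rw [rho_eq_dist_div_two] at h
  exact PiNat.eq_of_dist_eq_zero (toSeq x) (toSeq y) (by linarith)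

/-- `Σ₂` equipped with the metric `ρ`. -/
noncomputable instance : MetricSpace SigmaTwo where
  dist := rho
  dist_self := rho_self
  dist_comm := rho_comm
  dist_triangle := rho_triangle
  eq_of_dist_eq_zero := rho_eq_zero

noncomputable instance : MeasurableSpace SigmaTwo := borel SigmaTwo

instance : BorelSpace SigmaTwo := ⟨rfl⟩

/-- The symbolic multiplicative golden mean shift
`X_G = {(x_k) : x_k x_{2k} = 0 for all k ≥ 1}`. -/
def XG : Set SigmaTwo :=
  {x | ∀ k : ℕ, 1 ≤ k → (x (k - 1) : ℕ) * (x (2 * k - 1) : ℕ) = 0}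

/-- The (additive) golden mean shift `Σ_G = {(x_k) : x_k x_{k+1} = 0 for all k ≥ 1}`. -/
def SigmaG : Set SigmaTwo :=
  {x | ∀ k : ℕ, 1 ≤ k → (x (k - 1) : ℕ) * (x k : ℕ) = 0}

/-- The cylinder `[x_1 … x_n]`: all sequences agreeing with `x` in coordinates `1, …, n`. -/
def cylinder (x : SigmaTwo) (n : ℕ) : Set SigmaTwo := {y | ∀ i : ℕ, i < n → y i = x i}


/-- The cell of the partition `α_k` of `Σ_G` corresponding to a word `w = w_1 … w_k`:
the set of sequences in `Σ_G` starting with `w`. -/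
def cellG {k : ℕ} (w : Fin k → Fin 2) : Set SigmaTwo :=
  {y | y ∈ SigmaG ∧ ∀ i : Fin k, y (i : ℕ) = w i}

/-- `H^μ(α_k) = -∑_{C ∈ α_k} μ(C) log₂ μ(C)`, the base-2 entropy of the partition `α_k` of
`Σ_G` into cylinders of length `k` (cells of measure zero contribute `0`). -/
noncomputable def partEntropy (μ : Measure SigmaTwo) (k : ℕ) : ℝ :=
  -∑ w : Fin k → Fin 2, (μ (cellG w)).toReal * Real.logb 2 (μ (cellG w)).toReal

/-- `s(μ) = ∑_{k ≥ 1} H^μ(α_k) / 2^(k+1)`. -/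
noncomputable def sOf (μ : Measure SigmaTwo) : ℝ :=
  ∑' k : ℕ, partEntropy μ (k + 1) / 2 ^ (k + 2)

/-! ### Topology and measurability of `Σ₂` -/

theorem dist_le_iff_mem_cylinder (x y : SigmaTwo) (n : ℕ) :
    dist x y ≤ (1 / 2 : ℝ) ^ (n + 1) ↔ y ∈ cylinder x n := by
  change rho x y ≤ _ ↔ _
  rcases eq_or_ne x y with rfl | h
  · rw [rho_self]
    exact ⟨fun _ _ _ => rfl, fun _ => by positivity⟩
  · have h' : toSeq y ≠ toSeq x := fun e => h e.symm
    have hz : (2 : ℝ) ^ (-((PiNat.firstDiff (toSeq x) (toSeq y) : ℤ) + 1))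
        = (1 / 2 : ℝ) ^ (PiNat.firstDiff (toSeq x) (toSeq y) + 1) := by
      rw [zpow_neg, one_div, inv_pow]
      norm_cast
    rw [rho, if_neg h, hz,
      pow_le_pow_iff_right_of_lt_one₀ (by norm_num) (by norm_num), add_le_add_iff_right,
      PiNat.firstDiff_comm, ← PiNat.mem_cylinder_iff_le_firstDiff h']
    rfl

theorem cylinder_mem_nhds (x : SigmaTwo) (n : ℕ) : cylinder x n ∈ nhds x := by
  refine Metric.mem_nhds_iff.2 ⟨(1 / 2 : ℝ) ^ (n + 1), by positivity, fun y hy => ?_⟩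
  rw [← dist_le_iff_mem_cylinder, dist_comm]
  exact (Metric.mem_ball.1 hy).le

theorem cylinder_eq_of_mem {x y : SigmaTwo} {n : ℕ} (h : y ∈ cylinder x n) :
    cylinder x n = cylinder y n := by
  ext z
  exact forall₂_congr fun i hi => by rw [h i hi]

theorem measurable_apply (i : ℕ) : Measurable fun x : SigmaTwo => x i := by
  refine measurable_to_countable' fun a => IsOpen.measurableSet ?_
  refine isOpen_iff_mem_nhds.2 fun x hx => ?_
  filter_upwards [cylinder_mem_nhds x (i + 1)] with y hy
  exact (hy i i.lt_succ_self).trans hx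

/-- The first `k` coordinates of a sequence. -/
def word (k : ℕ) (x : SigmaTwo) : Fin k → Fin 2 := fun i => x i

theorem measurable_word (k : ℕ) : Measurable (word k) :=
  measurable_pi_lambda _ fun i => measurable_apply i

theorem preimage_word (k : ℕ) (x : SigmaTwo) : word k ⁻¹' {word k x} = cylinder x k := by
  ext y
  simp only [Set.mem_preimage, Set.mem_singleton_iff, funext_iff, word, cylinder, Set.mem_ofPred_eq]
  exact ⟨fun h i hi => h ⟨i, hi⟩, fun h i => h i i.2⟩

theorem measurableSet_cylinder (x : SigmaTwo) (k : ℕ) : MeasurableSet (cylinder x k) :=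
  preimage_word k x ▸ measurable_word k (measurableSet_singleton _)

theorem measurable_of_apply {α : Type*} [MeasurableSpace α] {f : α → SigmaTwo}
    (h : ∀ i, Measurable fun a => f a i) : Measurable f := by
  refine measurable_of_isOpen fun U hU => ?_
  have key : f ⁻¹' U = ⋃ (n : ℕ) (w : Fin n → Fin 2) (_ : word n ⁻¹' {w} ⊆ U),
      (fun a => word n (f a)) ⁻¹' {w} := by
    ext a
    simp only [Set.mem_preimage, Set.mem_iUnion, Set.mem_singleton_iff, exists_prop]
    constructor
    · intro ha
      obtain ⟨ε, hε, hb⟩ := Metric.isOpen_iff.1 hU _ ha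
      obtain ⟨n, hn⟩ := exists_pow_lt_of_lt_one hε (by norm_num : (1 / 2 : ℝ) < 1)
      refine ⟨n, word n (f a), ?_, rfl⟩
      rw [preimage_word]
      intro y hy
      rw [← dist_le_iff_mem_cylinder] at hy
      refine hb (Metric.mem_ball.2 ?_)
      rw [dist_comm]
      refine hy.trans_lt (lt_of_le_of_lt ?_ hn)
      exact pow_le_pow_of_le_one (by norm_num) (by norm_num) n.le_succ
    · rintro ⟨n, w, hw, rfl⟩
      exact hw rfl
  rw [key]
  refine .iUnion fun n => .iUnion fun w => .iUnion fun _ => ?_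
  exact (measurable_pi_lambda _ fun i : Fin n => h i) (measurableSet_singleton _)

theorem measurableSet_SigmaG : MeasurableSet SigmaG := by
  have : SigmaG = ⋂ (k : ℕ) (_ : 1 ≤ k), (fun x : SigmaTwo => (x (k - 1), x k)) ⁻¹'
      {p : Fin 2 × Fin 2 | (p.1 : ℕ) * (p.2 : ℕ) = 0} := by
    ext x
    simp [SigmaG]
  rw [this]
  exact .iInter fun k => .iInter fun _ =>
    ((measurable_apply (k - 1)).prodMk (measurable_apply k)) (Set.toFinite _).measurableSet

/-! ### The information function -/

/-- The base-2 information `-log₂ μ[y_1 … y_k]` of the cylinder of length `k` around `y`. -/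
noncomputable def info (μ : Measure SigmaTwo) (k : ℕ) (y : SigmaTwo) : ℝ :=
  -Real.logb 2 (μ (cylinder y k)).toReal

theorem info_eq_comp_word (μ : Measure SigmaTwo) (k : ℕ) :
    info μ k = (fun w => -Real.logb 2 (μ (word k ⁻¹' {w})).toReal) ∘ word k := by
  funext y
  rw [Function.comp_apply, preimage_word, info]

theorem measurable_info (μ : Measure SigmaTwo) (k : ℕ) : Measurable (info μ k) := by
  rw [info_eq_comp_word]
  exact (measurable_of_finite _).comp (measurable_word k)

theorem integrable_info (μ : Measure SigmaTwo) [IsProbabilityMeasure μ] (k : ℕ) :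
    Integrable (info μ k) μ := by
  rw [info_eq_comp_word]
  exact Integrable.comp_measurable .of_finite (measurable_word k)

theorem info_zero (μ : Measure SigmaTwo) [IsProbabilityMeasure μ] (y : SigmaTwo) :
    info μ 0 y = 0 := by
  have : cylinder y 0 = Set.univ := by
    ext; simp [cylinder]
  simp [info, this]

theorem measure_cylinder_le (μ : Measure SigmaTwo) [IsProbabilityMeasure μ] (k : ℕ)
    (y : SigmaTwo) : μ (cylinder y k) ≤ ENNReal.ofReal ((2 : ℝ) ^ (-info μ k y)) := by
  rcases eq_or_ne (μ (cylinder y k)) 0 with h | h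
  · simp [h]
  · rw [info, neg_neg, Real.rpow_logb (by norm_num) (by norm_num)
      (ENNReal.toReal_pos h (measure_ne_top _ _)), ENNReal.ofReal_toReal (measure_ne_top _ _)]

theorem measure_cellG {μ : Measure SigmaTwo} [IsProbabilityMeasure μ] (hμ : μ SigmaG = 1) {k : ℕ}
    (w : Fin k → Fin 2) : μ (cellG w) = μ (word k ⁻¹' {w}) := by
  have : cellG w = word k ⁻¹' {w} ∩ SigmaG := by
    ext y
    simp only [cellG, Set.mem_ofPred_eq, Set.mem_inter_iff, Set.mem_preimage,
      Set.mem_singleton_iff, funext_iff, word]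
    exact and_comm
  rw [this, measure_inter_conull ((prob_compl_eq_zero_iff measurableSet_SigmaG).2 hμ)]

theorem integral_info {μ : Measure SigmaTwo} [IsProbabilityMeasure μ] (hμ : μ SigmaG = 1)
    (k : ℕ) : ∫ y, info μ k y ∂μ = partEntropy μ k := by
  have hw := (measurable_word k).aemeasurable (μ := μ)
  rw [info_eq_comp_word]
  simp only [Function.comp_apply]
  rw [← integral_map (φ := word k)
    (f := fun w => -Real.logb 2 (μ (word k ⁻¹' {w})).toReal) hw
    (measurable_of_finite _).aestronglyMeasurable, integral_fintype .of_finite, partEntropy,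
    ← Finset.sum_neg_distrib]
  refine Finset.sum_congr rfl fun w _ => ?_
  rw [measure_cellG hμ, Measure.real, Measure.map_apply (measurable_word k)
    (measurableSet_singleton _), smul_eq_mul, mul_neg]

theorem partEntropy_nonneg (μ : Measure SigmaTwo) [IsProbabilityMeasure μ] (k : ℕ) :
    0 ≤ partEntropy μ k := by
  rw [partEntropy, neg_nonneg]
  exact Finset.sum_nonpos fun w _ => mul_nonpos_of_nonneg_of_nonpos ENNReal.toReal_nonneg
    (Real.logb_nonpos (by norm_num) ENNReal.toReal_nonneg
      (ENNReal.toReal_le_of_le_ofReal zero_le_one (by simpa using prob_le_one)))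

theorem partEntropy_zero {μ : Measure SigmaTwo} [IsProbabilityMeasure μ] (hμ : μ SigmaG = 1) :
    partEntropy μ 0 = 0 := by
  simp [← integral_info hμ, info_zero]

theorem sum_partEntropy_le {μ : Measure SigmaTwo} [IsProbabilityMeasure μ] (hμ : μ SigmaG = 1)
    (K : ℕ) : ∑ v ∈ Finset.range K, partEntropy μ (v + 1) / 2 ^ (v + 2) ≤
      ∑ v ∈ Finset.range K, (partEntropy μ (v + 1) - partEntropy μ v) / 2 ^ (v + 1) := by
  have h : ∑ v ∈ Finset.range K, (partEntropy μ (v + 1) - partEntropy μ v) / 2 ^ (v + 1) =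
      ∑ v ∈ Finset.range K, partEntropy μ (v + 1) / 2 ^ (v + 2)
        + partEntropy μ K / 2 ^ (K + 1) := by
    induction K with
    | zero => simp [partEntropy_zero hμ]
    | succ K ih =>
      rw [Finset.sum_range_succ, Finset.sum_range_succ, ih]
      field_simp
      ring
  rw [h]
  exact le_add_of_nonneg_right (div_nonneg (partEntropy_nonneg μ K) (by positivity))

/-! ### The multiplicative rearrangement and the law of large numbers -/

/-- The sequence whose subsequence along `{i, 2i, 4i, …}`, for `i = 2j + 1`, is `ω j`. -/
def fiberMap (ω : ℕ → SigmaTwo) : SigmaTwo :=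
  fun m => ω ((m + 1) / 2 ^ padicValNat 2 (m + 1) / 2) (padicValNat 2 (m + 1))

theorem fiberMap_apply (ω : ℕ → SigmaTwo) (v j : ℕ) :
    fiberMap ω (2 ^ v * (2 * j + 1) - 1) = ω j v := by
  have h1 : 2 ^ v * (2 * j + 1) - 1 + 1 = 2 ^ v * (2 * j + 1) :=
    Nat.sub_add_cancel (Nat.succ_le_of_lt (by positivity))
  have h2 : padicValNat 2 (2 ^ v * (2 * j + 1)) = v := by
    rw [padicValNat.mul (by positivity) (by positivity), padicValNat.prime_pow,
      padicValNat.eq_zero_of_not_dvd (by omega), add_zero]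
  rw [fiberMap, h1, h2, Nat.mul_div_cancel_left _ (by positivity)]
  congr 1
  omega

theorem measurable_fiberMap : Measurable fiberMap :=
  measurable_of_apply fun _ => (measurable_apply _).comp (measurable_pi_apply _)

theorem fiberMap_mem_XG {ω : ℕ → SigmaTwo} (h : ∀ j, ω j ∈ SigmaG) : fiberMap ω ∈ XG := by
  intro k hk
  obtain ⟨v, m, ⟨j, rfl⟩, rfl⟩ := Nat.exists_eq_two_pow_mul_odd (n := k) (by omega)
  rw [← mul_assoc, ← pow_succ', fiberMap_apply, fiberMap_apply]
  simpa using h j (v + 1) (by omega)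

/-- The conditional information of the `(v+1)`-st coordinate given the first `v` coordinates. -/
noncomputable def infoStep (μ : Measure SigmaTwo) (v : ℕ) (y : SigmaTwo) : ℝ :=
  info μ (v + 1) y - info μ v y

theorem sum_infoStep (μ : Measure SigmaTwo) [IsProbabilityMeasure μ] (c : ℕ) (y : SigmaTwo) :
    ∑ v ∈ Finset.range c, infoStep μ v y = info μ c y := by
  simp only [infoStep]
  rw [Finset.sum_range_sub (fun v => info μ v y), info_zero, sub_zero]

/-- The number of odd `i` with `2 ^ v * i ≤ n`. -/
def oddCount (v n : ℕ) : ℕ := (n + 2 ^ v) / 2 ^ (v + 1)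

theorem lt_oddCount_iff (v n j : ℕ) : j < oddCount v n ↔ 2 ^ v * (2 * j + 1) ≤ n := by
  rw [oddCount, ← Nat.succ_le_iff, Nat.le_div_iff_mul_le (by positivity), pow_succ,
    Nat.succ_eq_add_one]
  have : (j + 1) * (2 ^ v * 2) = 2 ^ v * (2 * j + 1) + 2 ^ v := by ring
  omega

theorem sum_info_min_size (μ : Measure SigmaTwo) [IsProbabilityMeasure μ] (K n : ℕ)
    (ω : ℕ → SigmaTwo) :
    ∑ j ∈ Finset.range n, info μ (min K (Nat.size (n / (2 * j + 1)))) (ω j) =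
      ∑ v ∈ Finset.range K, ∑ j ∈ Finset.range (oddCount v n), infoStep μ v (ω j) := by
  simp only [← sum_infoStep]
  refine Finset.sum_comm' fun j v => ?_
  simp only [Finset.mem_range, lt_min_iff, Nat.lt_size, lt_oddCount_iff,
    Nat.le_div_iff_mul_le (Nat.succ_pos (2 * j))]
  refine ⟨fun h => ⟨h.2.2, h.2.1⟩, fun h => ⟨?_, h.2, h.1⟩⟩
  have : 1 * (2 * j + 1) ≤ 2 ^ v * (2 * j + 1) := by gcongr; exact Nat.one_le_two_pow
  omega

theorem map_fiberMap_cylinder_le (μ : Measure SigmaTwo) [IsProbabilityMeasure μ] (K n : ℕ)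
    (ω : ℕ → SigmaTwo) :
    (Measure.infinitePi fun _ : ℕ => μ).map fiberMap (cylinder (fiberMap ω) n) ≤
      ENNReal.ofReal ((2 : ℝ) ^
        (-∑ v ∈ Finset.range K, ∑ j ∈ Finset.range (oddCount v n), infoStep μ v (ω j))) := by
  rw [Measure.map_apply measurable_fiberMap (measurableSet_cylinder _ _)]
  set c : ℕ → ℕ := fun j => min K (Nat.size (n / (2 * j + 1)))
  have hsub : fiberMap ⁻¹' cylinder (fiberMap ω) n ⊆
      Set.pi (Finset.range n) fun j => cylinder (ω j) (c j) := by
    intro η hη j _ v hv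
    rw [lt_min_iff, Nat.lt_size, Nat.le_div_iff_mul_le (Nat.succ_pos (2 * j)), Nat.succ_eq_add_one] at hv
    have h0 : 0 < 2 ^ v * (2 * j + 1) := by positivity
    simpa only [fiberMap_apply] using hη (2 ^ v * (2 * j + 1) - 1) (by omega)
  refine (measure_mono hsub).trans ?_
  rw [Measure.infinitePi_pi _ fun j _ => measurableSet_cylinder _ _, ← sum_info_min_size,
    ← Finset.sum_neg_distrib, Real.rpow_sum_of_pos two_pos,
    ENNReal.ofReal_prod_of_nonneg fun j _ => by positivity]
  exact Finset.prod_le_prod' fun j _ => measure_cylinder_le μ _ _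

theorem ae_forall_mem_SigmaG {μ : Measure SigmaTwo} [IsProbabilityMeasure μ]
    (hμ : μ SigmaG = 1) :
    ∀ᵐ ω ∂Measure.infinitePi fun _ : ℕ => μ, ∀ j, ω j ∈ SigmaG := by
  refine ae_all_iff.2 fun j => ?_
  exact (measurePreserving_eval_infinitePi (fun _ : ℕ => μ) j).quasiMeasurePreserving.ae
    (mem_ae_iff.2 ((prob_compl_eq_zero_iff measurableSet_SigmaG).2 hμ))

theorem ae_tendsto_sum_comp_eval_div {μ : Measure SigmaTwo} [IsProbabilityMeasure μ]
    {g : SigmaTwo → ℝ} (hm : Measurable g) (hint : Integrable g μ) :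
    ∀ᵐ ω ∂Measure.infinitePi fun _ : ℕ => μ,
      Tendsto (fun n : ℕ => (∑ j ∈ Finset.range n, g (ω j)) / n) atTop (nhds (∫ y, g y ∂μ)) := by
  set Q := Measure.infinitePi fun _ : ℕ => μ
  have hmp (j : ℕ) : MeasurePreserving (fun ω : ℕ → SigmaTwo => ω j) Q μ :=
    measurePreserving_eval_infinitePi (fun _ : ℕ => μ) j
  have hmap (j : ℕ) : Q.map (fun ω => g (ω j)) = μ.map g := by
    rw [← (hmp j).map_eq, Measure.map_map hm (hmp j).measurable]
    rfl
  have hE : ∫ ω, g (ω 0) ∂Q = ∫ y, g y ∂μ := by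
    rw [← (hmp 0).map_eq, integral_map (hmp 0).measurable.aemeasurable hm.aestronglyMeasurable]
  have hind := ProbabilityTheory.iIndepFun_infinitePi (P := fun _ : ℕ => μ) (X := fun _ => g)
    fun _ => hm
  rw [← hE]
  exact ProbabilityTheory.strong_law_ae_real (fun j (ω : ℕ → SigmaTwo) => g (ω j))
    ((hmp 0).integrable_comp_of_integrable hint) (fun i j hij => hind.indepFun hij)
    fun j => ⟨(hm.comp (hmp j).measurable).aemeasurable,
      (hm.comp (hmp 0).measurable).aemeasurable, (hmap j).trans (hmap 0).symm⟩

theorem ae_tendsto_sum_infoStep_div {μ : Measure SigmaTwo} [IsProbabilityMeasure μ]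
    (hμ : μ SigmaG = 1) (v : ℕ) :
    ∀ᵐ ω ∂Measure.infinitePi fun _ : ℕ => μ,
      Tendsto (fun n : ℕ => (∑ j ∈ Finset.range n, infoStep μ v (ω j)) / n) atTop
        (nhds (partEntropy μ (v + 1) - partEntropy μ v)) := by
  rw [← integral_info hμ, ← integral_info hμ,
    ← integral_sub (integrable_info μ _) (integrable_info μ _)]
  exact ae_tendsto_sum_comp_eval_div ((measurable_info μ _).sub (measurable_info μ _))
    ((integrable_info μ _).sub (integrable_info μ _))

theorem tendsto_oddCount_div (v : ℕ) :
    Tendsto (fun n : ℕ => (oddCount v n : ℝ) / ((n : ℝ) + 1)) atTop (nhds (1 / 2 ^ (v + 1))) := by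
  have h1 := tendsto_one_div_add_atTop_nhds_zero_nat (𝕜 := ℝ)
  have hlo : Tendsto (fun n : ℕ => 1 / 2 ^ (v + 1) - 2 * (1 / ((n : ℝ) + 1))) atTop
      (nhds (1 / 2 ^ (v + 1))) := by
    simpa using (h1.const_mul 2).const_sub ((1 : ℝ) / 2 ^ (v + 1))
  have hhi : Tendsto (fun n : ℕ => 1 / 2 ^ (v + 1) + 2 * (1 / ((n : ℝ) + 1))) atTop
      (nhds (1 / 2 ^ (v + 1))) := by
    simpa using (h1.const_mul 2).const_add ((1 : ℝ) / 2 ^ (v + 1))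
  have hp : (0 : ℝ) < 2 ^ (v + 1) := by positivity
  have h2 : (1 : ℝ) ≤ 2 ^ v := one_le_pow₀ (by norm_num)
  refine tendsto_of_tendsto_of_tendsto_of_le_of_le hlo hhi (fun n => ?_) fun n => ?_
  · have hn : (0 : ℝ) < (n : ℝ) + 1 := by positivity
    have hlt : ((n + 2 ^ v : ℕ) : ℝ) < 2 ^ (v + 1) * (oddCount v n + 1 : ℕ) := by
      exact_mod_cast Nat.lt_mul_div_succ _ (by positivity)
    push_cast at hlt
    simp only
    rw [le_div_iff₀ hn, sub_mul, mul_assoc, one_div_mul_cancel hn.ne', sub_le_iff_le_add,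
      one_div_mul_eq_div, div_le_iff₀ hp]
    nlinarith
  · have hn : (0 : ℝ) < (n : ℝ) + 1 := by positivity
    have hle : (oddCount v n : ℝ) * 2 ^ (v + 1) ≤ ((n + 2 ^ v : ℕ) : ℝ) := by
      exact_mod_cast Nat.div_mul_le_self _ _
    push_cast at hle
    simp only
    rw [div_le_iff₀ hn, add_mul, mul_assoc, one_div_mul_cancel hn.ne', ← sub_le_iff_le_add,
      one_div_mul_eq_div, le_div_iff₀ hp]
    rw [pow_succ] at *
    nlinarith

theorem tendsto_oddCount_atTop (v : ℕ) : Tendsto (oddCount v) atTop atTop := by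
  refine tendsto_atTop_atTop.2 fun b => ⟨2 ^ v * (2 * b + 1), fun n hn => ?_⟩
  exact ((lt_oddCount_iff v n b).2 hn).le

theorem ae_tendsto_sum_sum_infoStep_div {μ : Measure SigmaTwo} [IsProbabilityMeasure μ]
    (hμ : μ SigmaG = 1) (K : ℕ) :
    ∀ᵐ ω ∂Measure.infinitePi fun _ : ℕ => μ, Tendsto (fun n : ℕ =>
      (∑ v ∈ Finset.range K, ∑ j ∈ Finset.range (oddCount v n), infoStep μ v (ω j))
        / ((n : ℝ) + 1)) atTop
      (nhds (∑ v ∈ Finset.range K, (partEntropy μ (v + 1) - partEntropy μ v) / 2 ^ (v + 1))) := by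
  filter_upwards [ae_all_iff.2 fun v => ae_tendsto_sum_infoStep_div hμ v] with ω hω
  simp only [Finset.sum_div]
  refine tendsto_finsetSum _ fun v _ => ?_
  have h := ((hω v).comp (tendsto_oddCount_atTop v)).mul (tendsto_oddCount_div v)
  rw [mul_one_div] at h
  refine h.congr fun n => ?_
  simp only [Function.comp_apply, ← Finset.sum_div]
  rcases eq_or_ne (oddCount v n) 0 with h0 | h0
  · simp [h0]
  · have : (oddCount v n : ℝ) ≠ 0 := by exact_mod_cast h0
    field_simp

/-! ### Mass distribution -/

theorem le_dimH_of_measure_cylinder_le {P : Measure SigmaTwo} {A : Set SigmaTwo} {t : NNReal}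
    {N : ℕ} (ht : 0 < t)
    (hA : ∀ x ∈ A, ∀ n ≥ N, P (cylinder x n) ≤ ENNReal.ofReal ((1 / 2 : ℝ) ^ (n + 2)) ^ (t : ℝ))
    (hP : P A ≠ 0) : (t : ℝ≥0∞) ≤ dimH A := by
  refine le_dimH_of_hausdorffMeasure_ne_zero fun h0 => hP ?_
  have hbound (s : Set SigmaTwo) (n : ℕ) (hn : N ≤ n)
      (hs : Metric.ediam s ≤ ENNReal.ofReal ((1 / 2 : ℝ) ^ (n + 1))) :
      P.restrict A s ≤ ENNReal.ofReal ((1 / 2 : ℝ) ^ (n + 2)) ^ (t : ℝ) := by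
    rcases s.eq_empty_or_nonempty with rfl | ⟨x, hx⟩
    · simp
    have hsub : s ⊆ cylinder x n := fun y hy => by
      rw [← dist_le_iff_mem_cylinder, ← edist_le_ofReal (by positivity)]
      exact (Metric.edist_le_ediam_of_mem hx hy).trans hs
    refine (measure_mono hsub).trans ?_
    rw [Measure.restrict_apply (measurableSet_cylinder _ _)]
    rcases (cylinder x n ∩ A).eq_empty_or_nonempty with he | ⟨z, hz, hzA⟩
    · simp [he]
    refine (measure_mono Set.inter_subset_left).trans ?_
    rw [cylinder_eq_of_mem hz]
    exact hA z hzA n hn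
  have hle : P.restrict A ≤ Measure.hausdorffMeasure (t : ℝ) := by
    refine Measure.le_hausdorffMeasure _ _ (ENNReal.ofReal ((1 / 2 : ℝ) ^ (N + 1)))
      (ENNReal.ofReal_pos.2 (by positivity)) fun s hs => ?_
    have hfin : Metric.ediam s ≠ ∞ := ne_top_of_le_ne_top ENNReal.ofReal_ne_top hs
    rcases eq_or_ne (Metric.ediam s) 0 with hs0 | hs0
    · rw [hs0, ENNReal.zero_rpow_of_pos (by exact_mod_cast ht)]
      have hlim : Tendsto (fun n : ℕ => ENNReal.ofReal ((1 / 2 : ℝ) ^ (n + 2)) ^ (t : ℝ)) atTop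
          (nhds 0) := by
        have h1 : Tendsto (fun n : ℕ => (1 / 2 : ℝ) ^ (n + 2)) atTop (nhds 0) :=
          (tendsto_pow_atTop_nhds_zero_of_lt_one (by norm_num) (by norm_num)).comp
            (tendsto_add_atTop_nat 2)
        have h2 := ((ENNReal.continuous_rpow_const (y := (t : ℝ))).tendsto _).comp
          (ENNReal.tendsto_ofReal h1)
        rwa [ENNReal.ofReal_zero, ENNReal.zero_rpow_of_pos (by exact_mod_cast ht)] at h2
      refine ge_of_tendsto hlim ?_
      filter_upwards [eventually_ge_atTop N] with n hn
      exact hbound s n hn (by rw [hs0]; exact zero_le)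
    · have hd : 0 < (Metric.ediam s).toReal := ENNReal.toReal_pos hs0 hfin
      have hdN : (Metric.ediam s).toReal ≤ (1 / 2 : ℝ) ^ (N + 1) :=
        ENNReal.toReal_le_of_le_ofReal (by positivity) hs
      have hp : (1 / 2 : ℝ) ^ N ≤ 1 := pow_le_one₀ (by norm_num) (by norm_num)
      obtain ⟨n, hn1, hn2⟩ := exists_nat_pow_near_of_lt_one
        (x := 2 * (Metric.ediam s).toReal) (by positivity) (by rw [pow_succ] at hdN; linarith)
        (by norm_num : (0 : ℝ) < 1 / 2) (by norm_num)
      have hn : N ≤ n := by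
        have : (1 / 2 : ℝ) ^ (n + 1) < (1 / 2) ^ N := by rw [pow_succ _ N] at hdN; linarith
        exact Nat.lt_succ_iff.1
          ((pow_lt_pow_iff_right_of_lt_one₀ (by norm_num) (by norm_num)).1 this)
      refine (hbound s n hn ?_).trans (ENNReal.rpow_le_rpow ?_ t.2)
      · rw [ENNReal.le_ofReal_iff_toReal_le hfin (by positivity), pow_succ]
        linarith
      · refine ENNReal.ofReal_le_of_le_toReal ?_
        rw [pow_succ]
        linarith
  rw [← nonpos_iff_eq_zero, ← h0, ← Measure.restrict_apply_self P A]
  exact hle A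

theorem le_dimH_XG_of_lt {μ : Measure SigmaTwo} [IsProbabilityMeasure μ] (hμ : μ SigmaG = 1)
    (K : ℕ) {t : NNReal} (ht : 0 < t) (htK : (t : ℝ) <
      ∑ v ∈ Finset.range K, (partEntropy μ (v + 1) - partEntropy μ v) / 2 ^ (v + 1)) :
    (t : ℝ≥0∞) ≤ dimH XG := by
  set P := (Measure.infinitePi fun _ : ℕ => μ).map fiberMap
  set A : ℕ → Set SigmaTwo := fun N => {x | x ∈ XG ∧ ∀ n ≥ N,
    P (cylinder x n) ≤ ENNReal.ofReal ((1 / 2 : ℝ) ^ (n + 2)) ^ (t : ℝ)}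
  have hae : ∀ᵐ ω ∂Measure.infinitePi fun _ : ℕ => μ, fiberMap ω ∈ ⋃ N, A N := by
    filter_upwards [ae_forall_mem_SigmaG hμ, ae_tendsto_sum_sum_infoStep_div hμ K] with ω h1 h2
    have h3 : Tendsto (fun n : ℕ => (t : ℝ) + t * (1 / ((n : ℝ) + 1))) atTop (nhds t) := by
      simpa using (tendsto_one_div_add_atTop_nhds_zero_nat.const_mul (t : ℝ)).const_add (t : ℝ)
    obtain ⟨N, hN⟩ := eventually_atTop.1 (h3.eventually_lt h2 htK)
    refine Set.mem_iUnion.2 ⟨N, fiberMap_mem_XG h1, fun n hn => ?_⟩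
    refine (map_fiberMap_cylinder_le μ K n ω).trans ?_
    rw [ENNReal.ofReal_rpow_of_pos (by positivity), one_div, inv_pow, ← Real.rpow_natCast,
      ← Real.rpow_neg zero_le_two, ← Real.rpow_mul zero_le_two]
    refine ENNReal.ofReal_le_ofReal (Real.rpow_le_rpow_of_exponent_le one_le_two ?_)
    have h4 := hN n hn
    have hn1 : (0 : ℝ) < (n : ℝ) + 1 := by positivity
    rw [lt_div_iff₀ hn1, add_mul, mul_assoc, one_div_mul_cancel hn1.ne'] at h4
    push_cast
    linarith
  have hU : P (⋃ N, A N) ≠ 0 := by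
    refine ne_of_gt (lt_of_lt_of_le ?_ (Measure.le_map_apply measurable_fiberMap.aemeasurable _))
    have h1 : (Measure.infinitePi fun _ : ℕ => μ) (fiberMap ⁻¹' ⋃ N, A N) = 1 :=
      (measure_congr (eventuallyEq_univ.2 hae)).trans measure_univ
    rw [h1]
    exact zero_lt_one
  obtain ⟨N, hN⟩ : ∃ N, P (A N) ≠ 0 := by
    by_contra! h
    exact hU (measure_iUnion_null h)
  exact (le_dimH_of_measure_cylinder_le ht (fun x hx => hx.2) hN).trans
    (dimH_mono fun x hx => hx.1)

/-- For every Borel probability measure `μ` on `Σ_G`, the Hausdorff dimension of `X_G` is at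
least `s(μ) = ∑_{k ≥ 1} H^μ(α_k) / 2^{k+1}`. -/
theorem dimH_XG_ge_sOf (μ : Measure SigmaTwo) [IsProbabilityMeasure μ] (hμ : μ SigmaG = 1) :
    ENNReal.ofReal (sOf μ) ≤ dimH XG := by
  rcases eq_or_ne (dimH XG) ∞ with htop | htop
  · simp [htop]
  rw [ENNReal.ofReal_le_iff_le_toReal htop]
  refine Real.tsum_le_of_sum_range_le
    (fun k => div_nonneg (partEntropy_nonneg μ _) (by positivity)) fun K => ?_
  refine (sum_partEntropy_le hμ K).trans (le_of_forall_lt_imp_le_of_dense fun t ht => ?_)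
  rcases le_or_gt t 0 with h0 | h0
  · exact h0.trans ENNReal.toReal_nonneg
  lift t to NNReal using h0.le
  exact (ENNReal.ofReal_le_iff_le_toReal htop).1 (by
    simpa using le_dimH_XG_of_lt hμ K (by exact_mod_cast h0) ht)

end SigmaTwo
end

section
/- Let p be the unique real number in (0,1) satisfying p^3 = (1-p)^2. Then the Hausdorff dimension of X_G (with respect to the metric ρ on Σ₂) is at most -log₂ p. -/
open scoped ENNReal
open Filter MeasureTheory

namespace SigmaTwo

attribute [local instance] PiNat.dist

theorem dist_le_of_forall_lt_eq {x y : SigmaTwo} {n : ℕ} (h : ∀ i < n, x i = y i) :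
    dist x y ≤ (1 / 2 : ℝ) ^ n := by
  rcases eq_or_ne x y with rfl | hne
  · rw [dist_self]; positivity
  · have hne' : toSeq x ≠ toSeq y := hne
    have hn : n ≤ PiNat.firstDiff (toSeq x) (toSeq y) := by
      by_contra! hlt
      exact PiNat.apply_firstDiff_ne hne' (h _ hlt)
    change rho x y ≤ _
    rw [rho_eq_dist_div_two, PiNat.dist_eq_of_ne hne']
    have := pow_le_pow_of_le_one (by norm_num : (0 : ℝ) ≤ 1 / 2) (by norm_num) hn
    have : (0 : ℝ) ≤ (1 / 2 : ℝ) ^ PiNat.firstDiff (toSeq x) (toSeq y) := by positivity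
    linarith

/-- The cylinder of all sequences with a given initial word. -/
def wordCylinder {n : ℕ} (w : Fin n → Fin 2) : Set SigmaTwo := {x | ∀ i : Fin n, x i = w i}

theorem ediam_wordCylinder_le {n : ℕ} (w : Fin n → Fin 2) :
    Metric.ediam (wordCylinder w) ≤ ENNReal.ofReal ((1 / 2 : ℝ) ^ n) :=
  Metric.ediam_le_of_forall_dist_le fun _ hx _ hy =>
    dist_le_of_forall_lt_eq fun i hi => (hx ⟨i, hi⟩).trans (hy ⟨i, hi⟩).symm

/-- Upper half of Billingsley's lemma, for weights on words of total mass at most one at each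
length. -/
theorem dimH_le_of_frequently_pow_le {A : Set SigmaTwo} {s c : ℝ} (hs : 0 < s) (hc : 0 < c)
    (hsc : (1 / 2 : ℝ) ^ s < c) (W : (n : ℕ) → (Fin n → Fin 2) → ℝ)
    (hW₀ : ∀ n w, 0 ≤ W n w) (hW₁ : ∀ n, ∑ w, W n w ≤ 1)
    (hA : ∀ x ∈ A, ∃ᶠ n in atTop, c ^ n ≤ W n fun i => x i) :
    dimH A ≤ ENNReal.ofReal s := by
  classical
  set q : ℝ := (1 / 2 : ℝ) ^ s with hq
  have hq₀ : 0 < q := by positivity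
  set θ : ℝ := q / c with hθ
  have hθ₀ : 0 < θ := by positivity
  have hθ₁ : θ < 1 := (div_lt_one hc).2 hsc
  let ι : ℕ → Type := fun L => Σ l : ℕ, {w : Fin (L + l) → Fin 2 // c ^ (L + l) ≤ W (L + l) w}
  let t : ∀ L, ι L → Set SigmaTwo := fun L i => wordCylinder i.2.1
  have hr : Tendsto (fun L : ℕ => ENNReal.ofReal ((1 / 2 : ℝ) ^ L)) atTop (nhds 0) := by
    rw [← ENNReal.ofReal_zero]
    exact ENNReal.tendsto_ofReal
      (tendsto_pow_atTop_nhds_zero_of_lt_one (by norm_num) (by norm_num))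
  have hμ : Measure.hausdorffMeasure s A ≤
      liminf (fun L => ∑' i, Metric.ediam (t L i) ^ s) atTop := by
    refine Measure.hausdorffMeasure_le_liminf_tsum s A _ hr t ?_ ?_
    · refine Eventually.of_forall fun L i => (ediam_wordCylinder_le _).trans ?_
      exact ENNReal.ofReal_le_ofReal
        (pow_le_pow_of_le_one (by norm_num) (by norm_num) (Nat.le_add_right _ _))
    · refine Eventually.of_forall fun L x hx => ?_
      obtain ⟨n, hn, hnW⟩ := frequently_atTop.1 (hA x hx) L
      obtain ⟨l, rfl⟩ := Nat.exists_eq_add_of_le hn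
      exact Set.mem_iUnion.2 ⟨⟨l, ⟨fun i => x i, hnW⟩⟩, fun i => rfl⟩
  have hsum : ∀ L, ∑' i, Metric.ediam (t L i) ^ s ≤ ENNReal.ofReal (1 - θ)⁻¹ := by
    intro L
    rw [ENNReal.tsum_sigma' (f := fun i : ι L => Metric.ediam (t L i) ^ s)]
    calc _ ≤ ∑' l : ℕ, ENNReal.ofReal (θ ^ l) := by
          refine ENNReal.tsum_le_tsum fun l => ?_
          set n := L + l with hn
          rw [tsum_fintype]
          have hcard : (Fintype.card {w : Fin n → Fin 2 // c ^ n ≤ W n w} : ℝ) * c ^ n ≤ 1 := by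
            rw [Fintype.card_subtype, ← nsmul_eq_mul]
            calc _ ≤ ∑ w with c ^ n ≤ W n w, W n w :=
                  Finset.card_nsmul_le_sum _ _ _ fun w hw => (Finset.mem_filter.1 hw).2
              _ ≤ ∑ w, W n w :=
                  Finset.sum_le_sum_of_subset_of_nonneg (Finset.filter_subset _ _)
                    fun w _ _ => hW₀ n w
              _ ≤ 1 := hW₁ n
          have hterm : ∀ w : {w : Fin n → Fin 2 // c ^ n ≤ W n w},
              Metric.ediam (t L ⟨l, w⟩) ^ s ≤ ENNReal.ofReal (q ^ n) := by
            intro w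
            refine (ENNReal.rpow_le_rpow (ediam_wordCylinder_le _) hs.le).trans ?_
            rw [ENNReal.ofReal_rpow_of_nonneg (by positivity) hs.le, hq, Real.rpow_pow_comm
              (by norm_num)]
          refine (Finset.sum_le_card_nsmul _ _ _ fun w _ => hterm w).trans ?_
          rw [nsmul_eq_mul, ← ENNReal.ofReal_natCast, ← ENNReal.ofReal_mul (by positivity)]
          refine ENNReal.ofReal_le_ofReal ?_
          have hqn : q ^ n = c ^ n * θ ^ n := by
            rw [← mul_pow, hθ, mul_div_cancel₀ _ hc.ne']
          rw [hqn, ← mul_assoc]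
          calc _ ≤ 1 * θ ^ n := mul_le_mul_of_nonneg_right hcard (by positivity)
            _ ≤ θ ^ l := by
              rw [one_mul]
              exact pow_le_pow_of_le_one hθ₀.le hθ₁.le (Nat.le_add_left _ _)
      _ = ENNReal.ofReal (1 - θ)⁻¹ := by
          rw [← ENNReal.ofReal_tsum_of_nonneg (fun l => by positivity)
            (summable_geometric_of_lt_one hθ₀.le hθ₁), tsum_geometric_of_lt_one hθ₀.le hθ₁]
  have hfin : Measure.hausdorffMeasure ((s.toNNReal : NNReal) : ℝ) A ≠ ⊤ := by
    rw [Real.coe_toNNReal s hs.le]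
    refine ((hμ.trans (liminf_le_liminf (Eventually.of_forall hsum))).trans_lt ?_).ne
    rw [liminf_const]
    exact ENNReal.ofReal_lt_top
  exact dimH_le_of_hausdorffMeasure_ne_top hfin

/-- Transition probabilities of the golden mean Markov chain: from `1` to `0` with probability
one, and from `0` to `0` and `1` with probabilities `p` and `1 - p`. -/
def transition (p : ℝ) (a b : Fin 2) : ℝ :=
  if a = 1 then (if b = 0 then 1 else 0) else (if b = 0 then p else 1 - p)

theorem sum_transition (p : ℝ) (a : Fin 2) : ∑ b, transition p a b = 1 := by
  fin_cases a <;> simp [transition]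

theorem transition_nonneg {p : ℝ} (hp₀ : 0 ≤ p) (hp₁ : p ≤ 1) (a b : Fin 2) :
    0 ≤ transition p a b := by
  unfold transition
  split_ifs <;> linarith

/-- The multiplicative Markov measure of the cylinder of a word `w`: in the 0-indexed
representation the symbol at an odd index `i` is the successor of the one at `i / 2`, and the
symbols at even indices start independent chains. -/
def weight (p : ℝ) (n : ℕ) (w : Fin n → Fin 2) : ℝ :=
  ∏ i : Fin n,
    transition p (if Odd (i : ℕ) then w ⟨i / 2, (Nat.div_le_self _ _).trans_lt i.2⟩ else 0) (w i)

theorem weight_nonneg {p : ℝ} (hp₀ : 0 ≤ p) (hp₁ : p ≤ 1) (n : ℕ) (w : Fin n → Fin 2) :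
    0 ≤ weight p n w :=
  Finset.prod_nonneg fun _ _ => transition_nonneg hp₀ hp₁ _ _

theorem exists_weight_snoc (p : ℝ) (n : ℕ) (w : Fin n → Fin 2) :
    ∃ a : Fin 2, ∀ b : Fin 2,
      weight p (n + 1) (Fin.snoc w b : Fin (n + 1) → Fin 2) = weight p n w * transition p a b := by
  refine ⟨if h : Odd n then w ⟨n / 2, Nat.div_lt_self h.pos one_lt_two⟩ else 0, fun b => ?_⟩
  have hsnoc : ∀ (j : ℕ) (hj : j < n),
      (Fin.snoc w b : Fin (n + 1) → Fin 2) ⟨j, hj.trans (Nat.lt_succ_self n)⟩ = w ⟨j, hj⟩ :=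
    fun j hj => Fin.snoc_castSucc (α := fun _ => Fin 2) b w ⟨j, hj⟩
  rw [weight, Fin.prod_univ_castSucc]
  congr 1
  · refine Finset.prod_congr rfl fun i _ => ?_
    rw [Fin.snoc_castSucc]
    congr 2
    exact hsnoc _ ((Nat.div_le_self _ _).trans_lt i.2)
  · rw [Fin.snoc_last]
    congr 1
    by_cases h : Odd n
    · simp only [Fin.val_last, h, if_true, dif_pos]
      exact hsnoc _ (Nat.div_lt_self h.pos one_lt_two)
    · simp [h]

theorem sum_weight (p : ℝ) (n : ℕ) : ∑ w, weight p n w = 1 := by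
  induction n with
  | zero => simp [weight]
  | succ n ih =>
    rw [← (Fin.snocEquiv fun _ => Fin 2).sum_comp, Fintype.sum_prod_type_right, ← ih]
    refine Finset.sum_congr rfl fun w _ => ?_
    obtain ⟨a, ha⟩ := exists_weight_snoc p n w
    change ∑ b : Fin 2, weight p (n + 1) (Fin.snoc w b : Fin (n + 1) → Fin 2) = _
    simp_rw [ha]
    rw [← Finset.mul_sum, sum_transition, mul_one]

/-- The number of ones among the first `n` symbols. -/
def countOnes (x : SigmaTwo) (n : ℕ) : ℕ := ∑ i ∈ Finset.range n, (x i : ℕ)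

theorem countOnes_le (x : SigmaTwo) (n : ℕ) : countOnes x n ≤ n := by
  have h : countOnes x n ≤ ∑ _i ∈ Finset.range n, 1 :=
    Finset.sum_le_sum fun i _ => Nat.le_of_lt_succ (x i).2
  simpa using h

theorem transition_zero (r : ℝ) (hr : 1 - r ^ 2 = r ^ 3) (b : Fin 2) :
    transition (r ^ 2) 0 b = r ^ (2 + (b : ℕ)) := by
  fin_cases b <;> simp [transition, hr]

theorem transition_mul_pow (r : ℝ) (hr : 1 - r ^ 2 = r ^ 3) (a b : Fin 2)
    (hab : (a : ℕ) * (b : ℕ) = 0) :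
    transition (r ^ 2) a b * r ^ (2 * (a : ℕ)) = r ^ (2 + (b : ℕ)) := by
  fin_cases a <;> fin_cases b <;> simp_all [transition]

theorem weight_mul_pow (r : ℝ) (hr : 1 - r ^ 2 = r ^ 3) {x : SigmaTwo} (hx : x ∈ XG) (m : ℕ) :
    weight (r ^ 2) (2 * m) (fun i => x i) * r ^ (2 * countOnes x m) =
      r ^ (4 * m + countOnes x (2 * m)) := by
  induction m with
  | zero => simp [weight, countOnes]
  | succ m ih =>
    have hstep : weight (r ^ 2) (2 * (m + 1)) (fun i => x i) =
        weight (r ^ 2) (2 * m) (fun i => x i) * transition (r ^ 2) 0 (x (2 * m)) *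
          transition (r ^ 2) (x m) (x (2 * m + 1)) := by
      have hodd : Odd (2 * m + 1) := ⟨m, rfl⟩
      have hdiv : (2 * m + 1) / 2 = m := by omega
      change weight (r ^ 2) (2 * m + 1 + 1) (fun i => x i) = _
      simp only [weight]
      rw [Fin.prod_univ_castSucc, Fin.prod_univ_castSucc]
      have heven : ¬ Odd (2 * m) := Nat.not_odd_iff_even.2 (even_two_mul m)
      simp [hodd, hdiv, heven]
    have hxm : (x m : ℕ) * (x (2 * m + 1) : ℕ) = 0 := hx (m + 1) (by omega)
    have hm : countOnes x (m + 1) = countOnes x m + (x m : ℕ) := Finset.sum_range_succ _ _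
    have h2m : countOnes x (2 * (m + 1)) =
        countOnes x (2 * m) + (x (2 * m) : ℕ) + (x (2 * m + 1) : ℕ) := by
      change countOnes x (2 * m + 1 + 1) = _
      simp only [countOnes, Finset.sum_range_succ]
    have h₁ := transition_mul_pow r hr _ _ hxm
    calc _ = (weight (r ^ 2) (2 * m) (fun i => x i) * r ^ (2 * countOnes x m)) *
          transition (r ^ 2) 0 (x (2 * m)) *
          (transition (r ^ 2) (x m) (x (2 * m + 1)) * r ^ (2 * (x m : ℕ))) := by
            rw [hstep, hm, mul_add, pow_add]; ring
      _ = _ := by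
            rw [ih, h₁, transition_zero r hr, h2m, ← pow_add, ← pow_add]
            congr 1
            ring

/-- The density of ones cannot keep increasing by a fixed amount along the powers of two. -/
theorem frequently_countOnes_le (x : SigmaTwo) {δ : ℝ} (hδ : 0 < δ) :
    ∃ᶠ m in atTop, (countOnes x (2 * m) : ℝ) ≤ 2 * countOnes x m + δ * m := by
  rw [frequently_atTop]
  intro L
  by_contra! hcon
  have hgrow : ∀ j : ℕ, (δ / 2) * j * 2 ^ (L + j) ≤ countOnes x (2 ^ (L + j)) := by
    intro j
    induction j with
    | zero => simp
    | succ j ih =>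
      have hL : L ≤ 2 ^ (L + j) := (Nat.le_add_right L j).trans Nat.lt_two_pow_self.le
      have h := hcon _ hL
      have h2 : 2 ^ (L + (j + 1)) = 2 * 2 ^ (L + j) := by rw [← add_assoc, pow_succ, mul_comm]
      rw [h2]
      push_cast at h ⊢
      rw [← add_assoc, pow_succ]
      nlinarith
  obtain ⟨j, hj⟩ := exists_nat_gt (2 / δ)
  have h₁ := hgrow j
  have h₂ : (countOnes x (2 ^ (L + j)) : ℝ) ≤ 2 ^ (L + j) := by
    exact_mod_cast countOnes_le x (2 ^ (L + j))
  have h₃ : 1 < δ / 2 * j := by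
    rw [div_lt_iff₀ hδ] at hj
    linarith
  have h₄ : (0 : ℝ) < 2 ^ (L + j) := by positivity
  nlinarith

theorem frequently_rpow_le_weight {r η : ℝ} (hr₀ : 0 < r) (hr₁ : r ≤ 1)
    (hr : 1 - r ^ 2 = r ^ 3) (hη : 0 < η) {x : SigmaTwo} (hx : x ∈ XG) :
    ∃ᶠ n in atTop, (r ^ (2 + η)) ^ n ≤ weight (r ^ 2) n fun i => x i := by
  have htend : Tendsto (fun m : ℕ => 2 * m) atTop atTop :=
    tendsto_atTop_mono (fun m => Nat.le_mul_of_pos_left m two_pos) tendsto_id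
  refine htend.frequently
    (Frequently.mono (frequently_countOnes_le x (δ := 2 * η) (by positivity)) fun m hm => ?_)
  have hpos : 0 < r ^ (2 * countOnes x m) := by positivity
  refine le_of_mul_le_mul_right ?_ hpos
  rw [weight_mul_pow r hr hx, ← Real.rpow_natCast, ← Real.rpow_mul hr₀.le, ← Real.rpow_natCast,
    ← Real.rpow_natCast, ← Real.rpow_add hr₀]
  refine Real.rpow_le_rpow_of_exponent_ge hr₀ hr₁ ?_
  push_cast
  linarith

/-- Upper bound: `dim_H X_G ≤ -log₂ p` where `p ∈ (0,1)` satisfies `p³ = (1-p)²`. -/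
theorem dimH_XG_le (p : ℝ) (hp : p ∈ Set.Ioo (0 : ℝ) 1) (hpe : p ^ 3 = (1 - p) ^ 2) :
    dimH XG ≤ ENNReal.ofReal (-Real.logb 2 p) := by
  obtain ⟨hp₀, hp₁⟩ := hp
  set s₀ := -Real.logb 2 p with hs₀
  have hs₀pos : 0 < s₀ := neg_pos.2 (Real.logb_neg one_lt_two hp₀ hp₁)
  obtain ⟨r, hr₀, rfl⟩ : ∃ r : ℝ, 0 < r ∧ p = r ^ 2 :=
    ⟨√p, Real.sqrt_pos.2 hp₀, (Real.sq_sqrt hp₀.le).symm⟩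
  have hr₁ : r < 1 := by nlinarith
  have hr : 1 - r ^ 2 = r ^ 3 := by
    have hsq : (1 - r ^ 2) ^ 2 = (r ^ 3) ^ 2 := by rw [← hpe]; ring
    exact (pow_left_inj₀ (by linarith) (by positivity) two_ne_zero).1 hsq
  have hbound : ∀ η : ℝ, 0 < η → dimH XG ≤ ENNReal.ofReal (s₀ * (1 + η)) := by
    intro η hη
    refine dimH_le_of_frequently_pow_le (c := r ^ (2 + η)) (by positivity) (by positivity) ?_
      (weight (r ^ 2)) (weight_nonneg hp₀.le hp₁.le) (fun n => (sum_weight _ n).le)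
      (fun x hx => frequently_rpow_le_weight hr₀ hr₁.le hr hη hx)
    have h2 : (1 / 2 : ℝ) ^ s₀ = r ^ 2 := by
      rw [hs₀, one_div, Real.inv_rpow zero_le_two, ← Real.rpow_neg zero_le_two, neg_neg,
        Real.rpow_logb zero_lt_two (by norm_num) hp₀]
    rw [Real.rpow_mul (by norm_num), h2, ← Real.rpow_natCast, ← Real.rpow_mul hr₀.le]
    refine Real.rpow_lt_rpow_of_exponent_gt hr₀ hr₁ ?_
    push_cast
    linarith
  have hlim : Tendsto (fun η : ℝ => ENNReal.ofReal (s₀ * (1 + η))) (nhdsWithin 0 (Set.Ioi 0))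
      (nhds (ENNReal.ofReal s₀)) := by
    have hcont : Continuous fun η : ℝ => s₀ * (1 + η) := by fun_prop
    have h := (ENNReal.tendsto_ofReal (hcont.tendsto 0)).mono_left
      (nhdsWithin_le_nhds (s := Set.Ioi 0))
    simpa using h
  exact ge_of_tendsto hlim (eventually_nhdsWithin_of_forall hbound)

end SigmaTwo
end
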